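/- Let 0 < α < 2, let K ≥ 2, let p_1,…,p_K > 0 with Σ_{k=1}^K p_k = 1, let μ_1,…,μ_K be probability measures on ℝ^d each with finite α-th moment, and let μ := Σ_{k=1}^K p_k μ_k. Then Σ_{k=1}^K p_k Δ(μ_k;α) ≤ Δ(μ;α); equivalently, the Gini distance covariance gCov(α) := Δ(μ;α) − Σ_{k=1}^K p_k Δ(μ_k;α) is nonnegative, so that 0 ≤ ρ_g(α) ≤ 1 whenever Δ(μ;α) > 0, where ρ_g(α) := gCov(α)/Δ(μ;α). -/

import Mathlib

open MeasureTheory ProbabilityTheory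
open scoped ENNReal BigOperators

/-- The generalized Gini mean difference `Δ(μ,ν;α) = ∫∫ ‖x − y‖^α dμ(x) dν(y)`. -/
noncomputable def giniDelta {E : Type*} [NormedAddCommGroup E] [MeasurableSpace E]
    (α : ℝ) (μ ν : Measure E) : ℝ := ∫ x, ∫ y, ‖x - y‖ ^ α ∂ν ∂μ

/-- Energy-type inequality for a kernel. -/
def EnergyIneq {E : Type*} [MeasurableSpace E] (μ ν : Measure E) (k : E → E → ℝ≥0∞) : Prop :=
  (∫⁻ x, ∫⁻ y, k x y ∂μ ∂μ) + (∫⁻ x, ∫⁻ y, k x y ∂ν ∂ν) ≤ 2 * ∫⁻ x, ∫⁻ y, k x y ∂ν ∂μ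

lemma EnergyIneq.mul {E : Type*} [MeasurableSpace E] {μ ν : Measure E} [SFinite μ] [SFinite ν]
    {k : E → E → ℝ≥0∞}
    (hk : Measurable (fun q : E × E => k q.1 q.2)) (h : EnergyIneq μ ν k) (c : ℝ≥0∞) :
    EnergyIneq μ ν (fun x y => c * k x y) := by
  have key : ∀ (a b : Measure E) [SFinite a] [SFinite b],
      ∫⁻ x, ∫⁻ y, c * k x y ∂b ∂a = c * ∫⁻ x, ∫⁻ y, k x y ∂b ∂a := by
    intro a b _ _
    rw [← lintegral_const_mul]
    · congr 1 with x
      rw [lintegral_const_mul]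
      exact hk.comp (by fun_prop : Measurable fun y => (x, y))
    · exact hk.lintegral_prod_right'
  unfold EnergyIneq at *
  rw [key, key, key, ← mul_add, mul_left_comm]
  gcongr

lemma EnergyIneq.mix {E W : Type*} [MeasurableSpace E] [MeasurableSpace W]
    {μ ν : Measure E} [SFinite μ] [SFinite ν]
    (l : Measure W) [SFinite l] {F : W → E → E → ℝ≥0∞}
    (hF : Measurable (fun q : W × E × E => F q.1 q.2.1 q.2.2))
    (h : ∀ᵐ w ∂l, EnergyIneq μ ν (F w)) :
    EnergyIneq μ ν (fun x y => ∫⁻ w, F w x y ∂l) := by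
  have key : ∀ (a b : Measure E) [SFinite a] [SFinite b],
      ∫⁻ x, ∫⁻ y, ∫⁻ w, F w x y ∂l ∂b ∂a = ∫⁻ w, ∫⁻ x, ∫⁻ y, F w x y ∂b ∂a ∂l := by
    intro a b _ _
    have : ∀ x, ∫⁻ y, ∫⁻ w, F w x y ∂l ∂b = ∫⁻ w, ∫⁻ y, F w x y ∂b ∂l := by
      intro x
      apply lintegral_lintegral_swap
      exact (hF.comp (by fun_prop : Measurable fun q : E × W => (q.2, x, q.1))).aemeasurable
    simp_rw [this]
    apply lintegral_lintegral_swap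
    apply Measurable.aemeasurable
    exact Measurable.lintegral_prod_right' (f := fun q : (E × W) × E => F q.1.2 q.1.1 q.2)
      (hF.comp (by fun_prop : Measurable fun q : (E × W) × E => (q.1.2, q.1.1, q.2)))
  have keym : ∀ (a b : Measure E) [SFinite a] [SFinite b],
      Measurable fun w => ∫⁻ x, ∫⁻ y, F w x y ∂b ∂a := by
    intro a b _ _
    apply Measurable.lintegral_prod_right' (f := fun q : W × E => ∫⁻ y, F q.1 q.2 y ∂b)
    exact Measurable.lintegral_prod_right' (f := fun q : (W × E) × E => F q.1.1 q.1.2 q.2)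
      (hF.comp (by fun_prop : Measurable fun q : (W × E) × E => (q.1.1, q.1.2, q.2)))
  unfold EnergyIneq
  rw [key, key, key, ← lintegral_add_left (keym _ _), ← lintegral_const_mul _ (keym _ _)]
  exact lintegral_mono_ae h

lemma lint_eq {E : Type*} [MeasurableSpace E] {μ ν : Measure E} [SFinite μ] [SFinite ν]
    {k : E → E → ℝ} (h0 : ∀ x y, 0 ≤ k x y)
    (hi : Integrable (fun q : E × E => k q.1 q.2) (μ.prod ν))
    (hi1 : ∀ x, Integrable (k x) ν) :
    ∫⁻ x, ∫⁻ y, ENNReal.ofReal (k x y) ∂ν ∂μ = ENNReal.ofReal (∫ x, ∫ y, k x y ∂ν ∂μ) := by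
  rw [ofReal_integral_eq_lintegral_ofReal hi.integral_prod_left
    (Filter.Eventually.of_forall fun x => integral_nonneg (h0 x))]
  congr 1 with x
  rw [ofReal_integral_eq_lintegral_ofReal (hi1 x) (Filter.Eventually.of_forall (h0 x))]

lemma energy_sq {E : Type*} [MeasurableSpace E] {μ ν : Measure E} [IsProbabilityMeasure μ]
    [IsProbabilityMeasure ν] {f : E → ℝ} (hf : Measurable f) (hb : ∀ x, |f x| ≤ 1) :
    EnergyIneq μ ν (fun x y => ENNReal.ofReal ((f x - f y) ^ 2)) := by
  have hi : ∀ (a : Measure E) [IsProbabilityMeasure a], Integrable f a := fun a _ =>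
    Integrable.of_bound hf.aestronglyMeasurable 1 (Filter.Eventually.of_forall hb)
  have hi2 : ∀ (a : Measure E) [IsProbabilityMeasure a], Integrable (fun x => f x ^ 2) a :=
    fun a _ => Integrable.of_bound (hf.pow_const 2).aestronglyMeasurable 1
      (Filter.Eventually.of_forall fun x => by
        simpa using hb x)
  have hbd : ∀ x y, ‖(f x - f y) ^ 2‖ ≤ 4 := by
    intro x y
    have := abs_le.1 (hb x)
    have := abs_le.1 (hb y)
    rw [Real.norm_eq_abs, abs_of_nonneg (sq_nonneg _)]
    nlinarith
  have val : ∀ (a b : Measure E) [IsProbabilityMeasure a] [IsProbabilityMeasure b],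
      ∫ x, ∫ y, (f x - f y) ^ 2 ∂b ∂a
        = (∫ x, f x ^ 2 ∂a) + (∫ x, f x ^ 2 ∂b) - 2 * (∫ x, f x ∂a) * (∫ x, f x ∂b) := by
    intro a b _ _
    have h1 : ∀ x, ∫ y, (f x - f y) ^ 2 ∂b
        = f x ^ 2 - 2 * f x * (∫ y, f y ∂b) + ∫ y, f y ^ 2 ∂b := by
      intro x
      have : ∀ y, (f x - f y) ^ 2 = f x ^ 2 - (2 * f x) * f y + f y ^ 2 := fun y => by ring
      simp_rw [this]
      have j : Integrable (fun y => f x ^ 2 - (2 * f x) * f y) b :=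
        (integrable_const _).sub ((hi b).const_mul _)
      rw [integral_add j (hi2 b),
        integral_sub (integrable_const _) ((hi b).const_mul _), integral_const_mul]
      simp
    simp_rw [h1]
    have i1 : Integrable (fun x => 2 * f x * ∫ y, f y ∂b) a := ((hi a).const_mul 2).mul_const _
    have j : Integrable (fun x => f x ^ 2 - 2 * f x * ∫ y, f y ∂b) a := (hi2 a).sub i1
    rw [integral_add j (integrable_const _),
      integral_sub (hi2 a) i1, integral_mul_const, integral_const_mul]
    simp
    ring
  have le : ∀ (a b : Measure E) [IsProbabilityMeasure a] [IsProbabilityMeasure b],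
      ∫⁻ x, ∫⁻ y, ENNReal.ofReal ((f x - f y) ^ 2) ∂b ∂a
        = ENNReal.ofReal ((∫ x, f x ^ 2 ∂a) + (∫ x, f x ^ 2 ∂b)
          - 2 * (∫ x, f x ∂a) * (∫ x, f x ∂b)) := by
    intro a b _ _
    rw [← val, lint_eq (k := fun x y => (f x - f y) ^ 2) (fun _ _ => sq_nonneg _)]
    · exact Integrable.of_bound (by fun_prop) 4 (Filter.Eventually.of_forall fun q => hbd _ _)
    · intro x
      exact Integrable.of_bound (by fun_prop) 4 (Filter.Eventually.of_forall fun q => hbd _ _)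
  have nn : ∀ (a b : Measure E) [IsProbabilityMeasure a] [IsProbabilityMeasure b],
      0 ≤ (∫ x, f x ^ 2 ∂a) + (∫ x, f x ^ 2 ∂b) - 2 * (∫ x, f x ∂a) * (∫ x, f x ∂b) := by
    intro a b _ _
    rw [← val]
    exact integral_nonneg fun x => integral_nonneg fun y => sq_nonneg _
  unfold EnergyIneq
  rw [le, le, le, ← ENNReal.ofReal_add (nn _ _) (nn _ _),
    show (2 : ℝ≥0∞) = ENNReal.ofReal 2 by simp, ← ENNReal.ofReal_mul (by norm_num)]
  apply ENNReal.ofReal_le_ofReal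
  nlinarith [sq_nonneg ((∫ x, f x ∂μ) - (∫ x, f x ∂ν))]

section Gauss
variable {d : ℕ}
local notation "EE" => EuclideanSpace ℝ (Fin d)

lemma gauss_int {b : ℝ} (hb : 0 < b) : Integrable (fun z : EE => Real.exp (-b * ‖z‖ ^ 2)) := by
  have h := (GaussianFourier.integrable_cexp_neg_mul_sq_norm_add (V := EE)
    (b := (b : ℂ)) (by simpa) 0 0).norm
  convert h using 2 with z
  rw [Complex.norm_exp]
  norm_cast
  simp

lemma gauss_kernel {s : ℝ} (hs : 0 < s) (x y : EE) :
    ∫⁻ z : EE, ENNReal.ofReal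
      ((Real.exp (-(2 * s) * ‖x - z‖ ^ 2) - Real.exp (-(2 * s) * ‖y - z‖ ^ 2)) ^ 2)
    = ENNReal.ofReal (2 * ∫ z : EE, Real.exp (-(4 * s) * ‖z‖ ^ 2)) *
      ENNReal.ofReal (1 - Real.exp (-s * ‖x - y‖ ^ 2)) := by
  have h4 : (0 : ℝ) < 4 * s := by linarith
  have hi := gauss_int (d := d) h4
  have hsub : ∀ w : EE, Integrable (fun z : EE => Real.exp (-(4 * s) * ‖w - z‖ ^ 2)) :=
    fun w => hi.comp_sub_left w
  have hval : ∀ w : EE, ∫ z : EE, Real.exp (-(4 * s) * ‖w - z‖ ^ 2)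
      = ∫ z : EE, Real.exp (-(4 * s) * ‖z‖ ^ 2) := fun w =>
    integral_sub_left_eq_self (fun z : EE => Real.exp (-(4 * s) * ‖z‖ ^ 2)) volume w
  set m : EE := (1 / 2 : ℝ) • (x + y) with hm
  have hexp : ∀ z : EE,
      (Real.exp (-(2 * s) * ‖x - z‖ ^ 2) - Real.exp (-(2 * s) * ‖y - z‖ ^ 2)) ^ 2
      = Real.exp (-(4 * s) * ‖x - z‖ ^ 2) + Real.exp (-(4 * s) * ‖y - z‖ ^ 2)
        - 2 * Real.exp (-s * ‖x - y‖ ^ 2) * Real.exp (-(4 * s) * ‖m - z‖ ^ 2) := by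
    intro z
    have par := parallelogram_law_with_norm ℝ (x - z) (y - z)
    have e1 : (x - z) + (y - z) = (2 : ℝ) • (m - z) := by
      rw [hm]; module
    have e2 : (x - z) - (y - z) = x - y := by abel
    rw [e1, e2, norm_smul] at par
    simp only [Real.norm_ofNat] at par
    rw [sub_sq, ← Real.exp_nat_mul, ← Real.exp_nat_mul, mul_assoc, ← Real.exp_add,
      mul_assoc, ← Real.exp_add]
    have e3 : -(2 * s) * ‖x - z‖ ^ 2 + -(2 * s) * ‖y - z‖ ^ 2
      = -s * ‖x - y‖ ^ 2 + -(4 * s) * ‖m - z‖ ^ 2 := by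
      linear_combination s * par
    rw [e3]
    push_cast
    ring_nf
  simp_rw [hexp]
  have hA : Integrable (fun z : EE => Real.exp (-(4 * s) * ‖x - z‖ ^ 2)
      + Real.exp (-(4 * s) * ‖y - z‖ ^ 2)) := (hsub x).add (hsub y)
  have hI : Integrable (fun z : EE => Real.exp (-(4 * s) * ‖x - z‖ ^ 2)
      + Real.exp (-(4 * s) * ‖y - z‖ ^ 2)
        - 2 * Real.exp (-s * ‖x - y‖ ^ 2) * Real.exp (-(4 * s) * ‖m - z‖ ^ 2)) := ((hsub x).add (hsub y)).sub ((hsub m).const_mul (2 * Real.exp (-s * ‖x - y‖ ^ 2)))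
  have hnn : 0 ≤ ∫ z : EE, Real.exp (-(4 * s) * ‖z‖ ^ 2) :=
    integral_nonneg fun z => (Real.exp_pos _).le
  rw [← ofReal_integral_eq_lintegral_ofReal hI
    (Filter.Eventually.of_forall fun z => by
      simp only [Pi.zero_apply]
      rw [← hexp]; positivity)]
  rw [← ENNReal.ofReal_mul (by positivity)]
  congr 1
  rw [integral_sub hA ((hsub m).const_mul _),
    integral_add (hsub x) (hsub y), integral_const_mul, hval, hval, hval]
  ring

variable {μ ν : Measure (EuclideanSpace ℝ (Fin d))} [IsProbabilityMeasure μ]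
  [IsProbabilityMeasure ν]

lemma energy_gauss {s : ℝ} (hs : 0 < s) :
    EnergyIneq μ ν (fun x y => ENNReal.ofReal (1 - Real.exp (-s * ‖x - y‖ ^ 2))) := by
  set c := ENNReal.ofReal (2 * ∫ z : EE, Real.exp (-(4 * s) * ‖z‖ ^ 2)) with hc
  have hpos : 0 < ∫ z : EE, Real.exp (-(4 * s) * ‖z‖ ^ 2) := by
    rw [GaussianFourier.integral_rexp_neg_mul_sq_norm (by positivity)]
    positivity
  have hc0 : c ≠ 0 := by
    rw [hc]; simpa using hpos
  have h := EnergyIneq.mix (μ := μ) (ν := ν) (volume : Measure EE) (F := fun z x y =>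
    ENNReal.ofReal
      ((Real.exp (-(2 * s) * ‖x - z‖ ^ 2) - Real.exp (-(2 * s) * ‖y - z‖ ^ 2)) ^ 2))
    (by fun_prop) (Filter.Eventually.of_forall fun z => by
      apply energy_sq (f := fun x => Real.exp (-(2 * s) * ‖x - z‖ ^ 2)) (by fun_prop)
      intro x
      rw [abs_of_pos (Real.exp_pos _), Real.exp_le_one_iff]
      have : 0 ≤ s * ‖x - z‖ ^ 2 := by positivity
      linarith)
  simp_rw [gauss_kernel hs] at h
  have h2 := h.mul (by fun_prop) c⁻¹
  simp_rw [← mul_assoc, ← hc, ENNReal.inv_mul_cancel hc0 ENNReal.ofReal_ne_top, one_mul] at h2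
  exact h2

lemma exp_kernel {t : ℝ} (ht : 0 < t) {a : ℝ} (ha : 0 ≤ a) :
    ∫⁻ s in Set.Ioi (0 : ℝ), ENNReal.ofReal (Real.exp (-t * s)) *
      ENNReal.ofReal (1 - Real.exp (-s * a)) = ENNReal.ofReal (t⁻¹ - (t + a)⁻¹) := by
  have e : ∀ s : ℝ, ENNReal.ofReal (Real.exp (-t * s)) * ENNReal.ofReal (1 - Real.exp (-s * a))
      = ENNReal.ofReal (Real.exp (-t * s) - Real.exp (-(t + a) * s)) := by
    intro s
    rw [← ENNReal.ofReal_mul (Real.exp_pos _).le, mul_sub, ← Real.exp_add]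
    ring_nf
  simp_rw [e]
  have i1 := integrableOn_exp_mul_Ioi (a := -t) (by linarith) 0
  have i2 := integrableOn_exp_mul_Ioi (a := -(t + a)) (by linarith) 0
  have i3 : IntegrableOn (fun s : ℝ => Real.exp (-t * s) - Real.exp (-(t + a) * s))
    (Set.Ioi 0) := i1.sub i2
  rw [← ofReal_integral_eq_lintegral_ofReal i3]
  · rw [integral_sub i1 i2, integral_exp_mul_Ioi (by linarith), integral_exp_mul_Ioi (by linarith)]
    congr 1
    simp only [mul_zero, Real.exp_zero, neg_div_neg_eq, one_div]
  · filter_upwards [ae_restrict_mem measurableSet_Ioi] with s hs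
    simp only [Pi.zero_apply, sub_nonneg, Real.exp_le_exp]
    have : 0 ≤ a * s := mul_nonneg ha (le_of_lt hs)
    linarith

lemma energy_resolvent {t : ℝ} (ht : 0 < t) :
    EnergyIneq μ ν (fun x y => ENNReal.ofReal (t⁻¹ - (t + ‖x - y‖ ^ 2)⁻¹)) := by
  have h := EnergyIneq.mix (μ := μ) (ν := ν) (volume.restrict (Set.Ioi (0 : ℝ)))
    (F := fun s x y => ENNReal.ofReal (Real.exp (-t * s)) *
      ENNReal.ofReal (1 - Real.exp (-s * ‖x - y‖ ^ 2)))
    (by fun_prop) (by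
      filter_upwards [ae_restrict_mem measurableSet_Ioi] with s hs
      exact (energy_gauss hs).mul (by fun_prop) _)
  have e : ∀ x y : EE, _ := fun x y => exp_kernel ht (a := ‖x - y‖ ^ 2) (by positivity)
  simp_rw [e] at h
  exact h

lemma energy_rpow {α : ℝ} (hα : 0 < α) (hα2 : α < 2) :
    EnergyIneq μ ν (fun x y => ENNReal.ofReal (‖x - y‖ ^ α)) := by
  have hp : α / 2 ∈ Set.Ioo (0 : ℝ) 1 := ⟨by linarith, by linarith⟩
  have h := EnergyIneq.mix (μ := μ) (ν := ν) (volume.restrict (Set.Ioi (0 : ℝ)))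
    (F := fun t x y => ENNReal.ofReal (t ^ (α / 2)) *
      ENNReal.ofReal (t⁻¹ - (t + ‖x - y‖ ^ 2)⁻¹))
    (by fun_prop) (by
      filter_upwards [ae_restrict_mem measurableSet_Ioi] with t ht
      exact (energy_resolvent ht).mul (by fun_prop) _)
  set C := ∫ t in Set.Ioi (0 : ℝ), Real.rpowIntegrand₀₁ (α / 2) t 1 with hC
  have hCpos : 0 < C := Real.integral_rpowIntegrand₀₁_one_pos hp
  have e : ∀ x y : EE, ∫⁻ t in Set.Ioi (0 : ℝ), ENNReal.ofReal (t ^ (α / 2)) *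
      ENNReal.ofReal (t⁻¹ - (t + ‖x - y‖ ^ 2)⁻¹)
      = ENNReal.ofReal C * ENNReal.ofReal (‖x - y‖ ^ α) := by
    intro x y
    have h1 := Real.integral_rpowIntegrand₀₁_eq_rpow_mul_const hp (x := ‖x - y‖ ^ 2)
      (by positivity)
    have h2 : (‖x - y‖ ^ 2) ^ (α / 2) = ‖x - y‖ ^ α := by
      rw [← Real.rpow_natCast, ← Real.rpow_mul (norm_nonneg _)]
      congr 1
      push_cast
      ring
    rw [h2, mul_comm] at h1
    rw [← ENNReal.ofReal_mul hCpos.le, ← h1, ofReal_integral_eq_lintegral_ofReal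
      (Real.integrableOn_rpowIntegrand₀₁_Ioi hp (by positivity))]
    · apply setLIntegral_congr_fun measurableSet_Ioi
      intro t ht
      have ht' : (0 : ℝ) < t := ht
      simp only [Real.rpowIntegrand₀₁]
      rw [ENNReal.ofReal_mul (by positivity)]
    · filter_upwards [ae_restrict_mem measurableSet_Ioi] with t ht
      exact Real.rpowIntegrand₀₁_nonneg hp.1 (le_of_lt ht) (by positivity)
  simp_rw [e] at h
  have h2 := h.mul (by fun_prop) (ENNReal.ofReal C)⁻¹
  have hc0 : ENNReal.ofReal C ≠ 0 := by simpa using hCpos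
  simp_rw [← mul_assoc, ENNReal.inv_mul_cancel hc0 ENNReal.ofReal_ne_top, one_mul] at h2
  exact h2

lemma rpow_sub_le {α : ℝ} (hα : 0 < α) (x y : EE) :
    ‖x - y‖ ^ α ≤ 2 ^ α * (‖x‖ ^ α + ‖y‖ ^ α) := by
  have h1 : ‖x - y‖ ≤ 2 * max ‖x‖ ‖y‖ := by
    have := norm_sub_le x y
    have := le_max_left ‖x‖ ‖y‖
    have := le_max_right ‖x‖ ‖y‖
    linarith
  have hx : 0 ≤ ‖x‖ ^ α := by positivity
  have hy : 0 ≤ ‖y‖ ^ α := by positivity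
  calc ‖x - y‖ ^ α ≤ (2 * max ‖x‖ ‖y‖) ^ α := Real.rpow_le_rpow (norm_nonneg _) h1 hα.le
    _ = 2 ^ α * (max ‖x‖ ‖y‖) ^ α := Real.mul_rpow (by norm_num) (by positivity)
    _ ≤ _ := by
      gcongr
      rcases max_choice ‖x‖ ‖y‖ with h | h <;> rw [h] <;> linarith


lemma int_one {α : ℝ} (hα : 0 < α) (hμ : Integrable (fun x => ‖x‖ ^ α) μ)
    (x : EE) : Integrable (fun y => ‖x - y‖ ^ α) μ := by
  refine Integrable.mono' (((integrable_const (‖x‖ ^ α)).add hμ).const_mul (2 ^ α))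
    (Measurable.aestronglyMeasurable (by fun_prop)) (Filter.Eventually.of_forall fun y => ?_)
  rw [Real.norm_of_nonneg (by positivity)]
  exact rpow_sub_le hα x y

lemma int_two {α : ℝ} (hα : 0 < α) (hμ : Integrable (fun x => ‖x‖ ^ α) μ)
    (hν : Integrable (fun x => ‖x‖ ^ α) ν) :
    Integrable (fun q : EE × EE => ‖q.1 - q.2‖ ^ α) (μ.prod ν) := by
  refine Integrable.mono' (((hμ.comp_fst ν).add (hν.comp_snd μ)).const_mul (2 ^ α))
    (Measurable.aestronglyMeasurable (by fun_prop)) (Filter.Eventually.of_forall fun y => ?_)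
  rw [Real.norm_of_nonneg (by positivity)]
  exact rpow_sub_le hα _ _

lemma gini_nonneg {α : ℝ} (a b : Measure EE) : 0 ≤ giniDelta α a b :=
  integral_nonneg fun x => integral_nonneg fun y => by positivity

lemma gini_energy {α : ℝ} (hα : 0 < α) (hα2 : α < 2) (hμ : Integrable (fun x => ‖x‖ ^ α) μ)
    (hν : Integrable (fun x => ‖x‖ ^ α) ν) :
    giniDelta α μ μ + giniDelta α ν ν ≤ 2 * giniDelta α μ ν := by
  have h := energy_rpow (μ := μ) (ν := ν) hα hα2
  unfold EnergyIneq at h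
  have h0 : ∀ x y : EE, 0 ≤ ‖x - y‖ ^ α := fun x y => by positivity
  rw [lint_eq h0 (int_two hα hμ hμ) (int_one hα hμ), lint_eq h0 (int_two hα hν hν) (int_one hα hν),
    lint_eq h0 (int_two hα hμ hν) (int_one hα hν)] at h
  change ENNReal.ofReal (giniDelta α μ μ) + ENNReal.ofReal (giniDelta α ν ν)
    ≤ 2 * ENNReal.ofReal (giniDelta α μ ν) at h
  have h22 : 2 * ENNReal.ofReal (giniDelta α μ ν) = ENNReal.ofReal (2 * giniDelta α μ ν) := by
    rw [ENNReal.ofReal_mul (by norm_num), ENNReal.ofReal_ofNat]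
  rw [← ENNReal.ofReal_add (gini_nonneg _ _) (gini_nonneg _ _),
    h22] at h
  exact (ENNReal.ofReal_le_ofReal_iff (mul_nonneg (by norm_num) (gini_nonneg _ _))).1 h

end Gauss

lemma integral_mix {E : Type*} [MeasurableSpace E] {K : ℕ} {p : Fin K → ℝ} (hp : ∀ k, 0 < p k)
    (μs : Fin K → Measure E) {f : E → ℝ} (hf : ∀ k, Integrable f (μs k)) :
    ∫ x, f x ∂(∑ j, ENNReal.ofReal (p j) • μs j) = ∑ j, p j * ∫ x, f x ∂(μs j) := by
  rw [integral_finsetSum_measure fun i _ => (hf i).smul_measure ENNReal.ofReal_ne_top]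
  congr 1 with j
  rw [integral_smul_measure, ENNReal.toReal_ofReal (hp j).le, smul_eq_mul]

/-- For `0 < α < 2` and a mixture `μ = Σ p_k μ_k` of probability measures on
`ℝ^d` with finite `α`-th moments, `Σ_k p_k Δ(μ_k;α) ≤ Δ(μ;α)`, i.e. the Gini distance covariance
is nonnegative; hence `0 ≤ ρ_g(α) ≤ 1` whenever `Δ(μ;α) > 0`. -/
theorem gcov_nonneg_and_gini_correlation_range
    (d : ℕ) (α : ℝ) (hα : 0 < α) (hα2 : α < 2)
    (K : ℕ) (hK : 2 ≤ K) (p : Fin K → ℝ) (hp : ∀ k, 0 < p k) (hsum : ∑ k, p k = 1)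
    (μs : Fin K → Measure (EuclideanSpace ℝ (Fin d))) [∀ k, IsProbabilityMeasure (μs k)]
    (hmom : ∀ k, Integrable (fun x => ‖x‖ ^ α) (μs k)) :
    (∑ k, p k * giniDelta α (μs k) (μs k))
      ≤ giniDelta α (∑ j, ENNReal.ofReal (p j) • μs j) (∑ j, ENNReal.ofReal (p j) • μs j) ∧
    (0 < giniDelta α (∑ j, ENNReal.ofReal (p j) • μs j) (∑ j, ENNReal.ofReal (p j) • μs j) →
      0 ≤ (giniDelta α (∑ j, ENNReal.ofReal (p j) • μs j) (∑ j, ENNReal.ofReal (p j) • μs j)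
              - ∑ k, p k * giniDelta α (μs k) (μs k))
            / giniDelta α (∑ j, ENNReal.ofReal (p j) • μs j) (∑ j, ENNReal.ofReal (p j) • μs j) ∧
      (giniDelta α (∑ j, ENNReal.ofReal (p j) • μs j) (∑ j, ENNReal.ofReal (p j) • μs j)
              - ∑ k, p k * giniDelta α (μs k) (μs k))
            / giniDelta α (∑ j, ENNReal.ofReal (p j) • μs j) (∑ j, ENNReal.ofReal (p j) • μs j)
          ≤ 1) := by
  have hval : giniDelta α (∑ j, ENNReal.ofReal (p j) • μs j) (∑ j, ENNReal.ofReal (p j) • μs j)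
      = ∑ i, p i * ∑ j, p j * giniDelta α (μs i) (μs j) := by
    unfold giniDelta
    have h1 : ∀ x, ∫ y, ‖x - y‖ ^ α ∂(∑ j, ENNReal.ofReal (p j) • μs j)
        = ∑ j, p j * ∫ y, ‖x - y‖ ^ α ∂(μs j) := fun x =>
      integral_mix hp μs fun k => int_one hα (hmom k) x
    simp_rw [h1]
    have h2 : ∀ i j, Integrable (fun x => p j * ∫ y, ‖x - y‖ ^ α ∂(μs j)) (μs i) := fun i j =>
      ((int_two hα (hmom i) (hmom j)).integral_prod_left).const_mul _
    rw [integral_mix hp μs fun k => integrable_finsetSum _ fun j _ => h2 k j]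
    congr 1 with i
    rw [integral_finsetSum _ fun j _ => h2 i j]
    simp_rw [integral_const_mul]
  have hD0 : ∀ k, 0 ≤ giniDelta α (μs k) (μs k) := fun k => gini_nonneg _ _
  have main : (∑ k, p k * giniDelta α (μs k) (μs k))
      ≤ giniDelta α (∑ j, ENNReal.ofReal (p j) • μs j) (∑ j, ENNReal.ofReal (p j) • μs j) := by
    rw [hval]
    have e1 : ∑ i, p i * ∑ j, p j * ((giniDelta α (μs i) (μs i) + giniDelta α (μs j) (μs j)) / 2)
        = ∑ k, p k * giniDelta α (μs k) (μs k) := by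
      set S := ∑ k, p k * giniDelta α (μs k) (μs k) with hS
      have e2 : ∀ i, ∑ j, p j * ((giniDelta α (μs i) (μs i) + giniDelta α (μs j) (μs j)) / 2)
          = giniDelta α (μs i) (μs i) / 2 + S / 2 := by
        intro i
        have : ∀ j, p j * ((giniDelta α (μs i) (μs i) + giniDelta α (μs j) (μs j)) / 2)
          = p j * (giniDelta α (μs i) (μs i) / 2) + p j * giniDelta α (μs j) (μs j) / 2 :=
          fun j => by ring
        simp_rw [this]
        rw [Finset.sum_add_distrib, ← Finset.sum_mul, ← Finset.sum_div, hsum, one_mul]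
      simp_rw [e2, mul_add]
      rw [Finset.sum_add_distrib, ← Finset.sum_mul, hsum]
      simp_rw [← mul_div_assoc]
      rw [← Finset.sum_div, ← hS]
      ring
    rw [← e1]
    refine Finset.sum_le_sum fun i _ => mul_le_mul_of_nonneg_left
      (Finset.sum_le_sum fun j _ => mul_le_mul_of_nonneg_left ?_ (hp j).le) (hp i).le
    have := gini_energy hα hα2 (hmom i) (hmom j)
    linarith
  refine ⟨main, fun hpos => ⟨div_nonneg (by linarith) hpos.le, ?_⟩⟩
  rw [div_le_one hpos]
  have : 0 ≤ ∑ k, p k * giniDelta α (μs k) (μs k) :=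
    Finset.sum_nonneg fun k _ => mul_nonneg (hp k).le (hD0 k)
  linarith
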